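/- arXiv:1811.08958 — 2 statements merged into one kernel-verified Lean document; each statement's English description precedes it below -/
import Mathlib

section
/- Let e > 0, let f̂ : ℝ → ℝ be a nonnegative function, let f : ℝ → ℝ, and let S ≥ 0 be such that |f̂(y) − f(y)| ≤ S for all y ∈ ℝ. Then for every t ∈ ℝ, |max(f̂(t), e) − f̂(t)| / max(f(t), e) ≤ 2·( 1_{f(t) < 2e} + S²/e² ). -/
/-- Lemma 3 of the paper: bound on the relative truncation error of the
kernel density estimator. -/
theorem truncated_density_estimator_bound
    (e : ℝ) (he : 0 < e) (fhat f : ℝ → ℝ)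
    (hfhat_nonneg : ∀ y, 0 ≤ fhat y)
    (S : ℝ) (hS : 0 ≤ S)
    (hsup : ∀ y, |fhat y - f y| ≤ S) :
    ∀ t : ℝ,
      |max (fhat t) e - fhat t| / max (f t) e ≤
        2 * ((if f t < 2 * e then (1 : ℝ) else 0) + S ^ 2 / e ^ 2) := by
  intro t
  have hden : 0 < max (f t) e := lt_max_of_lt_right he
  have hsq : 0 ≤ S ^ 2 / e ^ 2 := by positivity
  rcases le_or_gt e (fhat t) with h | h
  · rw [max_eq_left h, sub_self, abs_zero, zero_div]
    split_ifs <;> linarith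
  · have hle : |max (fhat t) e - fhat t| / max (f t) e ≤ 1 := by
      rw [div_le_one hden, max_eq_right h.le, abs_of_pos (sub_pos.2 h)]
      linarith [hfhat_nonneg t, le_max_right (f t) e]
    split_ifs with hf
    · linarith
    · have heS : e ≤ S := by linarith [(abs_le.1 (hsup t)).1]
      have hone : 1 ≤ S ^ 2 / e ^ 2 := by
        rw [one_le_div (by positivity)]
        gcongr
      linarith
end

section
/- Let E be a real normed vector space, let m, m̂ ∈ E, let f, f̂ ∈ ℝ, and let e > 0. Then ‖ (1/max(f, e))·m − (1/max(f̂, e))·m̂ ‖ ≤ (‖m‖ / max(f, e)) · |f̂ − f| / e + ‖m̂ − m‖ / e. -/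
/-- Deterministic inequality underlying the bound on `A_{411n}` in the proof of
Lemma 5 of the paper. -/
theorem truncated_ratio_difference_bound
    {E : Type*} [NormedAddCommGroup E] [NormedSpace ℝ E]
    (m mhat : E) (f fhat : ℝ) (e : ℝ) (he : 0 < e) :
    ‖(1 / max f e) • m - (1 / max fhat e) • mhat‖ ≤
      (‖m‖ / max f e) * |fhat - f| / e + ‖mhat - m‖ / e := by
  have ha : 0 < max f e := lt_max_of_lt_right he
  have hb : 0 < max fhat e := lt_max_of_lt_right he
  have hbe : e ≤ max fhat e := le_max_right _ _
  have hlip : |max fhat e - max f e| ≤ |fhat - f| := abs_max_sub_max_le_abs fhat f e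
  have hsplit : (1 / max f e) • m - (1 / max fhat e) • mhat =
      ((max fhat e - max f e) / (max f e * max fhat e)) • m -
        (1 / max fhat e) • (mhat - m) := by
    have hcoef : (max fhat e - max f e) / (max f e * max fhat e) =
        1 / max f e - 1 / max fhat e := by
      field_simp
    rw [hcoef]
    module
  rw [hsplit]
  refine (norm_sub_le _ _).trans (add_le_add ?_ ?_)
  · rw [norm_smul, Real.norm_eq_abs, abs_div, abs_of_pos (mul_pos ha hb)]
    calc |max fhat e - max f e| / (max f e * max fhat e) * ‖m‖
        ≤ |fhat - f| / (max f e * e) * ‖m‖ := by gcongr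
      _ = ‖m‖ / max f e * |fhat - f| / e := by field_simp
  · rw [norm_smul, Real.norm_eq_abs, abs_of_pos (one_div_pos.mpr hb), one_div_mul_eq_div]
    gcongr
end
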